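/- arXiv:2011.12915 — 2 statements merged into one kernel-verified Lean document; each statement's English description precedes it below -/
import Mathlib

section
/- Let v_ε ∈ L²((0,T)×Ω_ε). For 0<h≪1 and z ∈ ℝⁿ with |z|<h it holds that ‖𝓣_ε v_ε(t,x+z,y) − 𝓣_ε v_ε(t,x,y)‖²_{L²((0,T)×Ω^{2h}×Y*)} ≤ Σ_{j∈{0,1}ⁿ} ‖δ_{ℓ} v_ε‖²_{L²((0,T)×Ω_ε^h)}, where ℓ=ℓ(ε,z,j)=j+[z/ε] and δ_ℓ v_ε(t,x)=v_ε(t,x+ℓε)−v_ε(t,x). -/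
open MeasureTheory Filter Topology Set Matrix

noncomputable section

/-- Points of `ℝⁿ`. -/
abbrev Vec (n : ℕ) := Fin n → ℝ

variable {n : ℕ}

/-- Euclidean norm on `Vec n`. -/
def nrm2 (x : Vec n) : ℝ := Real.sqrt (∑ i, (x i)^2)

/-- Euclidean inner product on `Vec n`. -/
def dotp (x y : Vec n) : ℝ := ∑ i, x i * y i

/-- Standard basis vector. -/
def stdB (n : ℕ) (i : Fin n) : Vec n := fun j => if j = i then (1:ℝ) else 0

/-- Open hyper-rectangle `(a,b)`. -/
def rect (a b : Vec n) : Set (Vec n) := {x | ∀ i, a i < x i ∧ x i < b i}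

/-- The open unit cell `Y = (0,1)ⁿ`. -/
def unitCell (n : ℕ) : Set (Vec n) := {y | ∀ i, 0 < y i ∧ y i < 1}

/-- The scaled and translated cell `ε (A + k)`. -/
def cellAt (ε : ℝ) (A : Set (Vec n)) (k : Fin n → ℤ) : Set (Vec n) :=
  (fun y : Vec n => fun i => ε * (y i + (k i : ℝ))) '' A

/-- Indices `K_ε` of the cells contained in `Ω`. -/
def Keps (ε : ℝ) (Ω : Set (Vec n)) : Set (Fin n → ℤ) :=
  {k | cellAt ε (unitCell n) k ⊆ Ω}

/-- The periodically perforated domain `Ω_ε`. -/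
def perfDom (ε : ℝ) (Ω Ystar : Set (Vec n)) : Set (Vec n) :=
  interior (⋃ k ∈ Keps ε Ω, cellAt ε (closure Ystar) k)

/-- The inner part `Ω^h = {x ∈ Ω : dist(x,∂Ω) > h}` of `Ω`. -/
def innerDom (h : ℝ) (Ω : Set (Vec n)) : Set (Vec n) :=
  {x ∈ Ω | h < Metric.infDist x (frontier Ω)}

/-- The perforated domain `Ω_ε^h` consisting of the `ε`-cells inside `Ω^h`. -/
def perfDomH (ε h : ℝ) (Ω Ystar : Set (Vec n)) : Set (Vec n) :=
  perfDom ε (innerDom h Ω) Ystar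

/-- The oscillating interior boundary `Γ_ε = ∂Ω_ε \ ∂Ω`. -/
def perfSurf (ε : ℝ) (Ω Ystar : Set (Vec n)) : Set (Vec n) :=
  frontier (perfDom ε Ω Ystar) \ frontier Ω

/-- Smooth test functions compactly supported in `A`. -/
def IsTestOn (A : Set (Vec n)) (φ : Vec n → ℝ) : Prop :=
  ContDiff ℝ (⊤:ℕ∞) φ ∧ HasCompactSupport φ ∧ tsupport φ ⊆ A

/-- `g` is the weak (distributional) gradient of `u` on `A`. -/
def HasWeakGradOn (u : Vec n → ℝ) (g : Vec n → Vec n) (A : Set (Vec n)) : Prop :=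
  ∀ φ : Vec n → ℝ, IsTestOn A φ → ∀ i,
    ∫ x in A, u x * (fderiv ℝ φ x (stdB n i)) = - ∫ x in A, g x i * φ x

/-- Square of the `L²(A)` norm. -/
def L2sq (A : Set (Vec n)) (u : Vec n → ℝ) : ℝ := ∫ x in A, (u x)^2

/-- Square of the `L²(A)ⁿ` norm of a vector field. -/
def L2sqV (A : Set (Vec n)) (g : Vec n → Vec n) : ℝ := ∫ x in A, ∑ i, (g x i)^2

/-- Square of the `𝓗_ε` norm `‖u‖²_{L²} + ε²‖∇u‖²_{L²}`. -/
def hepsSq (ε : ℝ) (A : Set (Vec n)) (u : Vec n → ℝ) (g : Vec n → Vec n) : ℝ :=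
  L2sq A u + ε^2 * L2sqV A g

/-- Square of the `H¹` norm. -/
def h1Sq (A : Set (Vec n)) (u : Vec n → ℝ) (g : Vec n → Vec n) : ℝ :=
  L2sq A u + L2sqV A g

/-- Dual norm of a functional `F` with respect to the `𝓗_ε`-norm. -/
def dualNormHeps (ε : ℝ) (A : Set (Vec n)) (F : (Vec n → ℝ) → ℝ) : ℝ :=
  sSup {r | ∃ φ g, HasWeakGradOn φ g A ∧ hepsSq ε A φ g ≤ 1 ∧ r = |F φ|}

/-- Dual norm of a functional `F` with respect to the `H¹`-norm. -/
def dualNormH1 (A : Set (Vec n)) (F : (Vec n → ℝ) → ℝ) : ℝ :=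
  sSup {r | ∃ φ g, HasWeakGradOn φ g A ∧ h1Sq A φ g ≤ 1 ∧ r = |F φ|}

/-- Smooth test functions compactly supported in time in `(0,T)`. -/
def IsTimeTest (T : ℝ) (ψ : ℝ → ℝ) : Prop :=
  ContDiff ℝ (⊤:ℕ∞) ψ ∧ HasCompactSupport ψ ∧ tsupport ψ ⊆ Set.Ioo 0 T

/-- `F` represents the generalized time derivative of `t ↦ v(t,·)` (as a functional on `H¹(A)`). -/
def IsTimeDerivOn (T : ℝ) (A : Set (Vec n)) (v : ℝ → Vec n → ℝ)
    (F : ℝ → (Vec n → ℝ) → ℝ) : Prop :=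
  ∀ ψ : ℝ → ℝ, IsTimeTest T ψ → ∀ φ : Vec n → ℝ, ContDiff ℝ (⊤:ℕ∞) φ →
    ∫ t in Set.Ioo 0 T, (∫ x in A, v t x * φ x) * deriv ψ t
      = - ∫ t in Set.Ioo 0 T, F t φ * ψ t

/-- The corner `ε[x/ε]` of the `ε`-cell containing `x`. -/
def cellCorner (ε : ℝ) (x : Vec n) : Vec n := fun i => ε * (⌊x i / ε⌋ : ℝ)

/-- The unfolding operator: `(𝓣_ε u)(x,y) = u(ε[x/ε] + εy)`. -/
def unf (ε : ℝ) (u : Vec n → ℝ) (x y : Vec n) : ℝ :=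
  u (fun i => cellCorner ε x i + ε * y i)

/-- The averaging operator `𝓤_ε` (the `L²`-adjoint of the unfolding operator). -/
def avgU (ε : ℝ) (Ystar : Set (Vec n)) (φ : Vec n → Vec n → ℝ) (x : Vec n) : ℝ :=
  ∫ y in Ystar, φ (fun i => cellCorner ε x i + ε * y i) (fun i => Int.fract (x i / ε))

/-- The shifted point `x + εℓ`. -/
def shiftPt (ε : ℝ) (ℓ : Fin n → ℤ) (x : Vec n) : Vec n := fun i => x i + ε * (ℓ i : ℝ)

/-- Difference between the `εℓ`-shifted function and the function: `δv(x) = v(x+εℓ) − v(x)`. -/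
def shiftDiff (ε : ℝ) (ℓ : Fin n → ℤ) (v : Vec n → ℝ) (x : Vec n) : ℝ :=
  v (shiftPt ε ℓ x) - v x

/-- `Y`-periodicity of a function on the cell variable. -/
def YPeriodic (φ : Vec n → ℝ) : Prop :=
  ∀ (y : Vec n) (k : Fin n → ℤ), φ (fun i => y i + (k i : ℝ)) = φ y

/-- Membership (with weak gradient `g`) in `𝓗₀¹(Y*)`, i.e. zero trace on `∂Y ∩ ∂Y*`
(test functions need not vanish near `Γ`, only away from it). -/
def MemH10 (Ystar Γ : Set (Vec n)) (u : Vec n → ℝ) (g : Vec n → Vec n) : Prop :=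
  ∀ φ : Vec n → ℝ, ContDiff ℝ (⊤:ℕ∞) φ → Disjoint (tsupport φ) Γ → ∀ i,
    ∫ y in Ystar, u y * (fderiv ℝ φ y (stdB n i)) = - ∫ y in Ystar, g y i * φ y

/-- Membership (with weak gradient `g`) in `H¹_per(Y*)`. -/
def MemH1per (Ystar Γ : Set (Vec n)) (u : Vec n → ℝ) (g : Vec n → Vec n) : Prop :=
  ∀ φ : Vec n → ℝ, ContDiff ℝ (⊤:ℕ∞) φ → YPeriodic φ →
    (∀ k : Fin n → ℤ, Disjoint (tsupport φ) ((fun y : Vec n => fun i => y i + (k i:ℝ)) '' Γ)) →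
    ∀ i, ∫ y in Ystar, u y * (fderiv ℝ φ y (stdB n i)) = - ∫ y in Ystar, g y i * φ y

/-- (Weak) two-scale convergence of a sequence defined on the perforated domains `A m`. -/
def TwoScaleConv (T : ℝ) (Ω Ystar : Set (Vec n)) (ε : ℕ → ℝ) (A : ℕ → Set (Vec n))
    (u : ℕ → ℝ → Vec n → ℝ) (u0 : ℝ → Vec n → Vec n → ℝ) : Prop :=
  ∀ φ : ℝ → Vec n → Vec n → ℝ,
    ContDiff ℝ (⊤:ℕ∞) (fun p : ℝ × Vec n × Vec n => φ p.1 p.2.1 p.2.2) →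
    (∀ t x, YPeriodic (φ t x)) →
    Tendsto (fun m => ∫ t in Set.Ioo 0 T, ∫ x in A m,
        u m t x * φ t x (fun i => Int.fract (x i / ε m)))
      atTop (𝓝 (∫ t in Set.Ioo 0 T, ∫ x in Ω, ∫ y in Ystar, u0 t x y * φ t x y))

/-- Strong two-scale convergence: two-scale convergence plus convergence of the `L²` norms. -/
def StrongTS (T : ℝ) (Ω Ystar : Set (Vec n)) (ε : ℕ → ℝ) (A : ℕ → Set (Vec n))
    (u : ℕ → ℝ → Vec n → ℝ) (u0 : ℝ → Vec n → Vec n → ℝ) : Prop :=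
  TwoScaleConv T Ω Ystar ε A u u0 ∧
  Tendsto (fun m => ∫ t in Set.Ioo 0 T, ∫ x in A m, (u m t x)^2)
    atTop (𝓝 (∫ t in Set.Ioo 0 T, ∫ x in Ω, ∫ y in Ystar, (u0 t x y)^2))

/-- Two-scale convergence on the oscillating surfaces `Γε m` (with surface Hausdorff measures). -/
def TwoScaleConvSurf (T : ℝ) (Ω Γ : Set (Vec n)) (ε : ℕ → ℝ) (Γε : ℕ → Set (Vec n))
    (u : ℕ → ℝ → Vec n → ℝ) (u0 : ℝ → Vec n → Vec n → ℝ) : Prop :=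
  ∀ φ : ℝ → Vec n → Vec n → ℝ,
    Continuous (fun p : ℝ × Vec n × Vec n => φ p.1 p.2.1 p.2.2) →
    (∀ t x, YPeriodic (φ t x)) →
    Tendsto (fun m => ε m * ∫ t in Set.Ioo 0 T, ∫ x in Γε m,
        u m t x * φ t x (fun i => Int.fract (x i / ε m)) ∂(μH[(n:ℝ)-1]))
      atTop
      (𝓝 (∫ t in Set.Ioo 0 T, ∫ x in Ω, ∫ y in Γ, u0 t x y * φ t x y ∂(μH[(n:ℝ)-1])))

/-- Square of the Gagliardo `H^β(A)` norm. -/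
def hBetaSq (β : ℝ) (A : Set (Vec n)) (u : Vec n → ℝ) : ℝ :=
  (∫ y in A, (u y)^2) +
    ∫ y in A, ∫ z in A, (u y - u z)^2 / (nrm2 (fun i => y i - z i)) ^ ((n:ℝ) + 2*β)

/-- Square of the `L²(Ω, H¹(Y*))`-norm of a two-scale pair. -/
def pairSq (Ω Ystar : Set (Vec n)) (φ : Vec n → Vec n → ℝ) (gφ : Vec n → Vec n → Vec n) : ℝ :=
  ∫ x in Ω, ∫ y in Ystar, ((φ x y)^2 + ∑ i, (gφ x y i)^2)

/-- Dual norm with respect to `L²(Ω, 𝓗₀¹(Y*))`. -/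
def dualNormL2H10 (Ω Ystar Γ : Set (Vec n)) (F : (Vec n → Vec n → ℝ) → ℝ) : ℝ :=
  sSup {r | ∃ φ gφ, (∀ x, MemH10 Ystar Γ (φ x) (gφ x)) ∧ pairSq Ω Ystar φ gφ ≤ 1 ∧ r = |F φ|}

/-- Dual norm with respect to `L²(Ω, H¹_per(Y*))`. -/
def dualNormL2H1per (Ω Ystar Γ : Set (Vec n)) (F : (Vec n → Vec n → ℝ) → ℝ) : ℝ :=
  sSup {r | ∃ φ gφ, (∀ x, MemH1per Ystar Γ (φ x) (gφ x)) ∧ pairSq Ω Ystar φ gφ ≤ 1 ∧ r = |F φ|}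

/-- Dual norm with respect to `H¹_per(Y*)`. -/
def dualNormH1perY (Ystar Γ : Set (Vec n)) (F : (Vec n → ℝ) → ℝ) : ℝ :=
  sSup {r | ∃ φ g, MemH1per Ystar Γ φ g ∧ h1Sq Ystar φ g ≤ 1 ∧ r = |F φ|}

/-- Generalized time derivative of a two-scale function, dual to `L²(Ω, H¹(Y*))`. -/
def IsTimeDerivOn2 (T : ℝ) (Ω Ystar : Set (Vec n)) (v : ℝ → Vec n → Vec n → ℝ)
    (F : ℝ → (Vec n → Vec n → ℝ) → ℝ) : Prop :=
  ∀ ψ : ℝ → ℝ, IsTimeTest T ψ → ∀ φ : Vec n → Vec n → ℝ,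
    ContDiff ℝ (⊤:ℕ∞) (fun p : Vec n × Vec n => φ p.1 p.2) →
    ∫ t in Set.Ioo 0 T, (∫ x in Ω, ∫ y in Ystar, v t x y * φ x y) * deriv ψ t
      = - ∫ t in Set.Ioo 0 T, F t φ * ψ t

/-- Jacobian matrix of a map `ℝⁿ → ℝⁿ`. -/
def jac (Sg : Vec n → Vec n) (x : Vec n) : Matrix (Fin n) (Fin n) ℝ :=
  Matrix.of fun i j => fderiv ℝ (fun z => Sg z i) x (stdB n j)

/-- Jacobian matrix in the cell variable of the limit map `S₀`. -/
def jacY (S0 : ℝ → Vec n → Vec n → Vec n) (t : ℝ) (x y : Vec n) : Matrix (Fin n) (Fin n) ℝ :=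
  Matrix.of fun i j => fderiv ℝ (fun z => S0 t x z i) y (stdB n j)

/-- The material velocity `v_ε = ∇S_ε⁻¹ ∂_t S_ε`. -/
def velo (S : ℝ → Vec n → Vec n) (t : ℝ) (x : Vec n) : Vec n :=
  (jac (S t) x)⁻¹.mulVec (fun i => deriv (fun s => S s x i) t)

/-- The geometric setting: `Ω = (a,b)` a hyper-rectangle with integer corners, `ε⁻¹ ∈ ℕ`,
`Y* ⊆ Y` connected and open, `Γ = ∂Y* \ ∂Y`. -/
def GeomOK (n : ℕ) (T : ℝ) (a b : Fin n → ℕ) (Ω Ystar Γ : Set (Vec n)) (ε : ℕ → ℝ) : Prop :=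
  0 < T ∧ 1 < n ∧ (∀ i, a i < b i) ∧
  Ω = rect (fun i => (a i : ℝ)) (fun i => (b i : ℝ)) ∧
  IsOpen Ystar ∧ IsConnected Ystar ∧ Ystar ⊆ unitCell n ∧
  Γ = frontier Ystar \ frontier (unitCell n) ∧
  (∀ m, 0 < ε m) ∧ (∀ m, ∃ N : ℕ, ε m * N = 1) ∧ Tendsto ε atTop (𝓝 0)

/-- Assumptions (A1)–(A6) on the family of transformations `S_ε` and the limit map `S₀`. -/
def AssumpA (T : ℝ) (Ω Ystar Γ : Set (Vec n)) (ε : ℕ → ℝ)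
    (S : ℕ → ℝ → Vec n → Vec n) (S0 : ℝ → Vec n → Vec n → Vec n)
    (c0 C0 C : ℝ) : Prop :=
  -- (A1): uniform C¹ bounds
  (∀ m, ContDiff ℝ 1 (fun p : ℝ × Vec n => S m p.1 p.2)) ∧
  (∀ m, ∀ t ∈ Set.Icc 0 T, ∀ x ∈ closure (perfDom (ε m) Ω Ystar),
      (ε m)⁻¹ * nrm2 (fun i => deriv (fun s => S m s x i) t)
        + nrm2 (S m t x)
        + Real.sqrt (∑ i, ∑ j, (jac (S m t) x i j)^2) ≤ C) ∧
  -- (A2): uniform bounds on the Jacobian determinant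
  (0 < c0 ∧ ∀ m, ∀ t ∈ Set.Icc 0 T, ∀ x ∈ closure (perfDom (ε m) Ω Ystar),
      c0 ≤ (jac (S m t) x).det ∧ (jac (S m t) x).det ≤ C0) ∧
  -- (A3): J_ε ∈ C¹ with ‖∂_t J_ε‖_{L²(𝓗_ε')} + ε‖∇J_ε‖_∞ ≤ C
  (∀ m, ContDiff ℝ 1 (fun p : ℝ × Vec n => (jac (S m p.1) p.2).det)) ∧
  (∀ m, (∫ t in Set.Ioo 0 T,
      (dualNormHeps (ε m) (perfDom (ε m) Ω Ystar)
        (fun φ => ∫ x in perfDom (ε m) Ω Ystar,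
          (deriv (fun s => (jac (S m s) x).det) t) * φ x))^2) ≤ C^2) ∧
  (∀ m, ∀ t ∈ Set.Icc 0 T, ∀ x ∈ closure (perfDom (ε m) Ω Ystar),
      ε m * nrm2 (fun i => fderiv ℝ (fun z => (jac (S m t) z).det) x (stdB n i)) ≤ C) ∧
  -- (A4): shift estimates for J_ε and ∇J_ε
  (∀ h : ℝ, 0 < h → ∀ m, ∀ ℓ : Fin n → ℤ, nrm2 (fun i => ε m * (ℓ i:ℝ)) < h →
    ∀ t ∈ Set.Icc 0 T, ∀ x ∈ closure (perfDomH (ε m) h Ω Ystar),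
      |(jac (S m t) (shiftPt (ε m) ℓ x)).det - (jac (S m t) x).det|
          ≤ C * nrm2 (fun i => ε m * (ℓ i:ℝ))
      ∧ nrm2 (fun i => fderiv ℝ (fun z => (jac (S m t) z).det) (shiftPt (ε m) ℓ x) (stdB n i)
            - fderiv ℝ (fun z => (jac (S m t) z).det) x (stdB n i))
          ≤ C * nrm2 (fun i => (ℓ i:ℝ))) ∧
  -- (A5): shift estimate for the velocity v_ε
  (∀ h : ℝ, 0 < h → ∀ m, ∀ ℓ : Fin n → ℤ, nrm2 (fun i => ε m * (ℓ i:ℝ)) < h →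
    ∀ t ∈ Set.Icc 0 T, ∀ x ∈ closure (perfDomH (ε m) h Ω Ystar),
      nrm2 (fun i => velo (S m) t (shiftPt (ε m) ℓ x) i - velo (S m) t x i)
        ≤ C * nrm2 (fun i => (ℓ i:ℝ)) * (ε m)^2) ∧
  -- (A6): regularity of S₀ and strong two-scale convergences
  Continuous (fun p : ℝ × Vec n × Vec n => S0 p.1 p.2.1 p.2.2) ∧
  (∀ x, ContDiff ℝ 1 (fun p : ℝ × Vec n => S0 p.1 x p.2)) ∧
  (∀ t x y (kk : Fin n → ℤ) i, S0 t x (fun j => y j + (kk j:ℝ)) i = S0 t x y i + (kk i:ℝ)) ∧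
  (∀ t ∈ Set.Icc 0 T, ∀ x ∈ closure Ω, Set.InjOn (S0 t x) Ystar) ∧
  (∀ i, StrongTS T Ω Ystar ε (fun m => perfDom (ε m) Ω Ystar)
      (fun m t x => S m t x i) (fun t x _ => x i)) ∧
  (∀ i j, StrongTS T Ω Ystar ε (fun m => perfDom (ε m) Ω Ystar)
      (fun m t x => jac (S m t) x i j) (fun t x y => jacY S0 t x y i j)) ∧
  (∀ i j, StrongTS T Ω Ystar ε (fun m => perfDom (ε m) Ω Ystar)
      (fun m t x => (jac (S m t) x)⁻¹ i j) (fun t x y => (jacY S0 t x y)⁻¹ i j)) ∧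
  (∀ i, StrongTS T Ω Ystar ε (fun m => perfDom (ε m) Ω Ystar)
      (fun m t x => (ε m)⁻¹ * deriv (fun s => S m s x i) t)
      (fun t x y => deriv (fun s => S0 s x y i) t))

/-- Assumptions (AD1)–(AD4) on the data. -/
def AssumpD (T : ℝ) (Ω Ystar Γ : Set (Vec n)) (ε : ℕ → ℝ)
    (q : ℕ → ℝ → Vec n → Vec n) (f g : ℝ → ℝ → ℝ) (Dmat : Matrix (Fin n) (Fin n) ℝ)
    (u0 : ℕ → Vec n → ℝ) (U0 : Vec n → Vec n → ℝ) (C : ℝ) : Prop :=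
  -- (AD1): uniform L^∞ bound for q_ε
  (∀ m, ∀ t ∈ Set.Ioo 0 T, ∀ x ∈ perfDom (ε m) Ω Ystar, nrm2 (q m t x) ≤ C) ∧
  -- (AD1): shift estimate for q_ε
  (∀ h : ℝ, 0 < h → ∀ m, ∀ ℓ : Fin n → ℤ, nrm2 (fun i => ε m * (ℓ i:ℝ)) < h →
     ∀ t ∈ Set.Ioo 0 T, ∀ x ∈ perfDomH (ε m) h Ω Ystar,
       nrm2 (fun i => q m t (shiftPt (ε m) ℓ x) i - q m t x i)
         ≤ C * nrm2 (fun i => ε m * (ℓ i:ℝ))) ∧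
  -- (AD2): f, g globally Lipschitz uniformly in time, and square integrable
  (∀ t ∈ Set.Ioo 0 T, ∀ z1 z2 : ℝ,
      |f t z1 - f t z2| ≤ C * |z1 - z2| ∧ |g t z1 - g t z2| ≤ C * |z1 - z2|) ∧
  IntegrableOn (fun p : ℝ × ℝ => (f p.1 p.2)^2) ((Set.Ioo 0 T) ×ˢ (Set.univ : Set ℝ)) ∧
  IntegrableOn (fun p : ℝ × ℝ => (g p.1 p.2)^2) ((Set.Ioo 0 T) ×ˢ (Set.univ : Set ℝ)) ∧
  -- (AD3): D symmetric and positive definite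
  Dmat.IsSymm ∧ (∀ ξ : Vec n, ξ ≠ 0 → 0 < dotp (Dmat.mulVec ξ) ξ) ∧
  -- (AD4): uniform L² bound, shift continuity and two-scale convergence of the initial data
  (∀ m, L2sq (perfDom (ε m) Ω Ystar) (u0 m) ≤ C^2) ∧
  (∀ h : ℝ, 0 < h → ∀ η : ℝ, 0 < η → ∃ δ : ℝ, 0 < δ ∧ ∀ m, ∀ ℓ : Fin n → ℤ,
      nrm2 (fun i => ε m * (ℓ i:ℝ)) < δ → nrm2 (fun i => ε m * (ℓ i:ℝ)) < h →
      L2sq (perfDomH (ε m) h Ω Ystar) (shiftDiff (ε m) ℓ (u0 m)) < η) ∧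
  TwoScaleConv T Ω Ystar ε (fun m => perfDom (ε m) Ω Ystar)
    (fun m _ x => u0 m x) (fun _ x y => U0 x y)

/-- Weak solution of the transformed microscopic problem (P_T). -/
def IsWeakSolPT (T ε : ℝ) (Ωε Γε : Set (Vec n))
    (J : ℝ → Vec n → ℝ) (Dm : ℝ → Vec n → Matrix (Fin n) (Fin n) ℝ)
    (q v : ℝ → Vec n → Vec n) (f g : ℝ → ℝ → ℝ) (u0 : Vec n → ℝ)
    (u : ℝ → Vec n → ℝ) (gu : ℝ → Vec n → Vec n)
    (F : ℝ → (Vec n → ℝ) → ℝ) : Prop :=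
  -- u ∈ L²((0,T), H¹(Ω_ε)) with weak spatial gradient gu
  (∀ᵐ t ∂(volume.restrict (Set.Ioo 0 T)), HasWeakGradOn (u t) (gu t) Ωε) ∧
  IntegrableOn (fun p : ℝ × Vec n => (u p.1 p.2)^2) ((Set.Ioo 0 T) ×ˢ Ωε) ∧
  IntegrableOn (fun p : ℝ × Vec n => ∑ i, (gu p.1 p.2 i)^2) ((Set.Ioo 0 T) ×ˢ Ωε) ∧
  -- F represents ∂_t(J_ε u_ε) ∈ L²((0,T), H¹(Ω_ε)')
  IsTimeDerivOn T Ωε (fun t x => J t x * u t x) F ∧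
  -- initial condition
  (∀ x ∈ Ωε, u 0 x = u0 x) ∧
  -- variational equation
  (∀ φ gφ, HasWeakGradOn φ gφ Ωε →
    ∀ᵐ t ∂(volume.restrict (Set.Ioo 0 T)),
      F t φ
      + ∫ x in Ωε, dotp (fun i =>
            ε^2 * J t x * ((Dm t x).mulVec (gu t x)) i
            - ε * J t x * q t x i * u t x
            + J t x * v t x i * u t x) (gφ x)
      = (∫ x in Ωε, J t x * f t (u t x) * φ x)
        + ε * ∫ x in Γε, J t x * g t (u t x) * φ x ∂(μH[(n:ℝ)-1]))


lemma s9_innerDom_iff {n : ℕ} (hn : 1 < n) (a b : Vec n) (h : ℝ) (hh : 0 < h) (x : Vec n) :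
    x ∈ innerDom h (rect a b) ↔ ∀ i, a i + h < x i ∧ x i < b i - h := by
  have hcl : ∀ x ∈ rect a b, ∀ i, Function.update x i (a i) ∈ frontier (rect a b) ∧
      Function.update x i (b i) ∈ frontier (rect a b) := by
    intro x hx i
    have hre : rect a b = Set.pi Set.univ (fun i => Set.Ioo (a i) (b i)) := by
      ext y; simp [rect, Set.mem_pi]
    have hopen : IsOpen (rect a b) := by
      rw [hre]; exact isOpen_set_pi Set.finite_univ (fun i _ => isOpen_Ioo)
    have hc : closure (rect a b) = Set.pi Set.univ (fun i => Set.Icc (a i) (b i)) := by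
      rw [hre, closure_pi_set]
      congr 1; ext1 i
      exact closure_Ioo ((hx i).1.trans (hx i).2).ne
    rw [hopen.frontier_eq, hc]
    refine ⟨⟨?_, ?_⟩, ?_, ?_⟩
    · intro k _
      by_cases hk : k = i
      · subst hk; simpa using ((hx k).1.trans (hx k).2).le
      · simpa [hk] using ⟨(hx k).1.le, (hx k).2.le⟩
    · intro hmem
      simpa using (hmem i).1
    · intro k _
      by_cases hk : k = i
      · subst hk; simpa using ((hx k).1.trans (hx k).2).le
      · simpa [hk] using ⟨(hx k).1.le, (hx k).2.le⟩
    · intro hmem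
      simpa using (hmem i).2
  have hopen : IsOpen (rect a b) := by
    have hre : rect a b = Set.pi Set.univ (fun i => Set.Ioo (a i) (b i)) := by
      ext y; simp [rect, Set.mem_pi]
    rw [hre]; exact isOpen_set_pi Set.finite_univ (fun i _ => isOpen_Ioo)
  have hupd : ∀ (i : Fin n) (c : ℝ), dist x (Function.update x i c) ≤ |x i - c| := by
    intro i c
    rw [dist_pi_le_iff (abs_nonneg _)]
    intro k
    by_cases hk : k = i
    · subst hk; simp [Real.dist_eq]
    · simp [hk]
  constructor
  · rintro ⟨hx, hd⟩ i
    have h1 := (Metric.infDist_le_dist_of_mem (x := x) (hcl x hx i).1).trans (hupd i _)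
    have h2 := (Metric.infDist_le_dist_of_mem (x := x) (hcl x hx i).2).trans (hupd i _)
    have := hx i
    rw [abs_of_pos (by linarith)] at h1
    rw [abs_of_neg (by linarith)] at h2
    constructor <;> linarith
  · intro hx
    have hxr : x ∈ rect a b := fun i => ⟨by linarith [(hx i).1], by linarith [(hx i).2]⟩
    refine ⟨hxr, ?_⟩
    have hne : (frontier (rect a b)).Nonempty := ⟨_, (hcl x hxr ⟨0, by omega⟩).1⟩
    obtain ⟨p, hp, hpd⟩ := isClosed_frontier.exists_infDist_eq_dist hne x
    rw [hpd]
    rw [hopen.frontier_eq] at hp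
    have : ∃ i, ¬ (a i < p i ∧ p i < b i) := by
      by_contra hcon
      push Not at hcon
      exact hp.2 (fun i => hcon i)
    obtain ⟨i, hi⟩ := this
    refine lt_of_lt_of_le ?_ (dist_le_pi_dist x p i)
    rw [Real.dist_eq, lt_abs]
    by_cases h1 : a i < p i
    · right
      have : b i ≤ p i := by
        by_contra h2
        exact hi ⟨h1, not_le.mp h2⟩
      linarith [(hx i).2]
    · left
      linarith [(hx i).1]

lemma s9_cellAt_mem {n : ℕ} (ε : ℝ) (hε : 0 < ε) (A : Set (Vec n)) (k : Fin n → ℤ) (x : Vec n) :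
    x ∈ cellAt ε A k ↔ (fun i => x i / ε - k i) ∈ A := by
  constructor
  · rintro ⟨y, hy, rfl⟩
    convert hy using 2
    field_simp
    ring
  · intro hx
    refine ⟨_, hx, ?_⟩
    funext i
    field_simp
    ring

lemma s9_Keps_iff {n : ℕ} (ε : ℝ) (hε : 0 < ε) (a b : Vec n) (k : Fin n → ℤ) :
    k ∈ Keps ε (rect a b) ↔ ∀ i, a i ≤ ε * k i ∧ ε * (k i + 1) ≤ b i := by
  constructor
  · intro hk i
    have key : ∀ s : ℝ, 0 < s → s < 1 → a i < ε * (s + k i) ∧ ε * (s + k i) < b i := by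
      intro s h0 h1
      exact hk ⟨fun _ => s, fun _ => ⟨h0, h1⟩, rfl⟩ i
    constructor
    · by_contra hc
      push Not at hc
      have := (key (min (1/2) ((a i - ε * k i) / ε)) (by
        have : 0 < (a i - ε * k i) / ε := div_pos (by linarith) hε
        exact lt_min (by norm_num) this) (lt_of_le_of_lt (min_le_left _ _) (by norm_num))).1
      have h2 := mul_le_mul_of_nonneg_left (min_le_right (1/2) ((a i - ε * k i) / ε)) hε.le
      rw [mul_div_cancel₀ _ hε.ne'] at h2
      nlinarith
    · by_contra hc
      push Not at hc
      have := (key (1 - min (1/2) ((ε * (k i + 1) - b i) / ε)) (by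
        have := min_le_left (1/2) ((ε * (k i + 1) - b i) / ε)
        linarith) (by
        have : 0 < (ε * (k i + 1) - b i) / ε := div_pos (by linarith) hε
        have := lt_min (by norm_num : (0:ℝ) < 1/2) this
        linarith)).2
      have h2 := mul_le_mul_of_nonneg_left (min_le_right (1/2) ((ε * (k i + 1) - b i) / ε)) hε.le
      rw [mul_div_cancel₀ _ hε.ne'] at h2
      nlinarith
  · rintro hk x ⟨y, hy, rfl⟩ i
    have h1 := mul_pos hε (hy i).1
    have h2 := mul_lt_mul_of_pos_left (hy i).2 hε
    have := hk i
    constructor <;> dsimp only <;> nlinarith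

lemma s9_innerDom_eq {n : ℕ} (hn : 1 < n) (a b : Vec n) (h : ℝ) (hh : 0 < h) :
    innerDom h (rect a b) = rect (fun i => a i + h) (fun i => b i - h) := by
  ext x
  rw [s9_innerDom_iff hn a b h hh]
  rfl

lemma s9_abs_le_nrm2 {n : ℕ} (z : Vec n) (i : Fin n) : |z i| ≤ nrm2 z := by
  unfold nrm2
  apply Real.abs_le_sqrt
  exact Finset.single_le_sum (f := fun i => (z i)^2) (fun j _ => sq_nonneg _) (Finset.mem_univ i)

lemma s9_ofReal_integral_le {α : Type*} [MeasurableSpace α] (μ : Measure α) (f : α → ℝ)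
    (hf : ∀ x, 0 ≤ f x) : ENNReal.ofReal (∫ x, f x ∂μ) ≤ ∫⁻ x, ENNReal.ofReal (f x) ∂μ := by
  by_cases hi : Integrable f μ
  · rw [ofReal_integral_eq_lintegral_ofReal hi (Eventually.of_forall hf)]
  · rw [integral_undef hi]; simp

lemma s9_lintegral_cell {n : ℕ} (ε : ℝ) (hε : 0 < ε) (A : Set (Vec n)) (hA : MeasurableSet A)
    (k : Fin n → ℤ) (g : Vec n → ENNReal) :
    ∫⁻ x in cellAt ε A k, g x =
      ENNReal.ofReal (ε ^ n) * ∫⁻ y in A, g (fun i => ε * (y i + k i)) := by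
  have hd : ∀ x ∈ A, HasFDerivWithinAt (fun y : Vec n => fun i => ε * (y i + (k i : ℝ)))
      (ε • ContinuousLinearMap.id ℝ (Vec n)) A x := by
    intro x _
    have : (fun y : Vec n => fun i => ε * (y i + (k i : ℝ))) =
        fun y : Vec n => ε • (y + fun i => (k i : ℝ)) := by
      funext y i; simp
    rw [this]
    exact (((hasFDerivAt_id x).add_const _).const_smul ε).hasFDerivWithinAt
  have hinj : InjOn (fun y : Vec n => fun i => ε * (y i + (k i : ℝ))) A := by
    intro x _ y _ hxy
    funext i
    have := congrFun hxy i
    have := mul_left_cancel₀ hε.ne' this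
    linarith
  unfold cellAt
  rw [lintegral_image_eq_lintegral_abs_det_fderiv_mul volume hA hd hinj]
  have hdet : |(ε • ContinuousLinearMap.id ℝ (Vec n)).det| = ε ^ n := by
    have : (ε • ContinuousLinearMap.id ℝ (Vec n)).det = ε ^ n := by
      simp [ContinuousLinearMap.det]
    rw [this, abs_of_pos (by positivity)]
  rw [hdet, lintegral_const_mul' _ _ ENNReal.ofReal_ne_top]

lemma s9_space {n : ℕ} (ε : ℝ) (hε : 0 < ε) (Ystar : Set (Vec n)) (hYo : IsOpen Ystar)
    (hY : Ystar ⊆ unitCell n) (O I : Set (Vec n))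
    (hsubK : ∀ x ∈ I, (fun i => ⌊x i / ε⌋) ∈ Keps ε O) (z : Vec n) (w : Vec n → ℝ)
    (hw : Measurable w) :
    (∫⁻ x in I, ∫⁻ y in Ystar,
        ENNReal.ofReal ((unf ε w (fun i => x i + z i) y - unf ε w x y)^2))
      ≤ ∑ j : Fin n → Bool, ∫⁻ x in perfDom ε O Ystar,
          ENNReal.ofReal ((shiftDiff ε (fun i => (if j i then 1 else 0) + ⌊z i / ε⌋) w x)^2) := by
  set D : Vec n → ENNReal := fun x => ∑ j : Fin n → Bool,
    ENNReal.ofReal ((shiftDiff ε (fun i => (if j i then 1 else 0) + ⌊z i / ε⌋) w x)^2) with hD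
  have hsm : ∀ ℓ : Fin n → ℤ, Measurable (fun x => ENNReal.ofReal ((shiftDiff ε ℓ w x)^2)) := by
    intro ℓ
    have : Measurable (shiftPt (n := n) ε ℓ) := by
      unfold shiftPt; fun_prop
    have := hw.comp this
    unfold shiftDiff
    exact ((this.sub hw).pow_const 2).ennreal_ofReal
  rw [← lintegral_finsetSum _ (fun j _ => hsm _)]
  change _ ≤ ∫⁻ x in perfDom ε O Ystar, D x
  let Cl : (Fin n → ℤ) → Set (Vec n) := fun k => Set.pi Set.univ
    (fun i => Set.Ico (ε * k i) (ε * (k i + 1)))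
  have hCl : ∀ k x, x ∈ Cl k ↔ ∀ i, ⌊x i / ε⌋ = k i := by
    intro k x
    simp only [Cl, Set.mem_pi, Set.mem_univ, true_imp_iff, Set.mem_Ico]
    refine forall_congr' fun i => ?_
    rw [Int.floor_eq_iff, le_div_iff₀ hε, div_lt_iff₀ hε, mul_comm ε, mul_comm ε]
  have hvol : ∀ k, volume (Cl k) = ENNReal.ofReal (ε ^ n) := by
    intro k
    simp only [Cl]
    rw [volume_pi_pi]
    simp only [Real.volume_Ico]
    have : ∀ i, ε * ((k i : ℝ) + 1) - ε * k i = ε := fun i => by ring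
    simp only [this]
    rw [Finset.prod_const, ENNReal.ofReal_pow hε.le]
    simp
  have hpt : ∀ x y : Vec n, ENNReal.ofReal ((unf ε w (fun i => x i + z i) y - unf ε w x y)^2)
      ≤ D (fun i => ε * (y i + (⌊x i / ε⌋ : ℤ))) := by
    intro x y
    have hj : ∀ i, ∃ c : Bool, ⌊(x i + z i) / ε⌋ = ⌊x i / ε⌋ + ((if c then 1 else 0) + ⌊z i / ε⌋) := by
      intro i
      rw [add_div]
      have h1 := Int.le_floor_add (x i / ε) (z i / ε)
      have h2 := Int.le_floor_add_floor (x i / ε) (z i / ε)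
      by_cases hc : ⌊x i / ε + z i / ε⌋ = ⌊x i / ε⌋ + ⌊z i / ε⌋
      · exact ⟨false, by simp [hc]⟩
      · exact ⟨true, by simp; omega⟩
    choose j hj using hj
    refine le_trans (le_of_eq ?_) (Finset.single_le_sum (f := fun j : Fin n → Bool =>
      ENNReal.ofReal ((shiftDiff ε (fun i => (if j i then 1 else 0) + ⌊z i / ε⌋) w
        (fun i => ε * (y i + (⌊x i / ε⌋ : ℤ))))^2)) (fun _ _ => bot_le) (Finset.mem_univ j))
    have e1 : unf ε w x y = w (fun i => ε * (y i + (⌊x i / ε⌋ : ℤ))) := by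
      unfold unf cellCorner
      congr 1; funext i; ring
    have e2 : unf ε w (fun i => x i + z i) y = w (shiftPt ε
        (fun i => (if j i then 1 else 0) + ⌊z i / ε⌋) (fun i => ε * (y i + (⌊x i / ε⌋ : ℤ)))) := by
      unfold unf cellCorner shiftPt
      congr 1; funext i
      rw [hj i]; push_cast; ring
    rw [e1, e2]; rfl
  have hsub : I ⊆ ⋃ k ∈ Keps ε O, Cl k := by
    intro x hx
    simp only [Set.mem_iUnion]
    exact ⟨_, hsubK x hx, (hCl _ _).2 fun _ => rfl⟩
  have hcount : (Keps ε O).Countable := Set.to_countable _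
  have hClm : ∀ k, MeasurableSet (Cl k) := fun k =>
    MeasurableSet.univ_pi fun i => measurableSet_Ico
  have hopen : ∀ k, IsOpen (cellAt ε Ystar k) := by
    intro k
    have : cellAt ε Ystar k = (fun x : Vec n => fun i => x i / ε - k i) ⁻¹' Ystar := by
      ext x; exact s9_cellAt_mem ε hε _ k x
    rw [this]
    exact hYo.preimage (by fun_prop)
  have hfl : ∀ k, cellAt ε Ystar k ⊆ Cl k := by
    intro k x hx
    rw [s9_cellAt_mem ε hε] at hx
    rw [hCl]
    intro i
    have := hY hx i
    rw [Int.floor_eq_iff]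
    constructor <;> linarith
  have hdC : Pairwise (fun k l => Disjoint (Cl k) (Cl l)) := by
    intro k l hkl
    rw [Set.disjoint_left]
    intro x hx hx'
    exact hkl (funext fun i => ((hCl k x).1 hx i).symm.trans ((hCl l x).1 hx' i))
  calc _ ≤ ∫⁻ x in ⋃ k ∈ Keps ε O, Cl k, ∫⁻ y in Ystar, D (fun i => ε * (y i + (⌊x i / ε⌋ : ℤ))) := by
        refine (lintegral_mono_set hsub).trans ?_
        exact lintegral_mono fun x => lintegral_mono fun y => hpt x y
    _ = ∑' k : Keps ε O, ∫⁻ x in Cl k, ∫⁻ y in Ystar, D (fun i => ε * (y i + (⌊x i / ε⌋ : ℤ))) := by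
        exact lintegral_biUnion hcount (fun k _ => hClm k) (fun k _ l _ hkl => hdC hkl) _
    _ = ∑' k : Keps ε O, ∫⁻ x in cellAt ε Ystar k, D x := by
        congr 1; funext k
        rw [s9_lintegral_cell ε hε _ hYo.measurableSet, ← hvol k, mul_comm, ← setLIntegral_const]
        refine setLIntegral_congr_fun (hClm _) ?_
        intro x hx
        have := (hCl _ _).1 hx
        simp only [this]
    _ = ∫⁻ x in ⋃ k ∈ Keps ε O, cellAt ε Ystar k, D x := by
        refine (lintegral_biUnion hcount (fun k _ => (hopen k).measurableSet) ?_ _).symm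
        intro k _ l _ hkl
        exact (hdC hkl).mono (hfl k) (hfl l)
    _ ≤ _ := by
        refine lintegral_mono_set ?_
        refine interior_maximal ?_ (isOpen_biUnion fun k _ => hopen k)
        exact Set.iUnion₂_mono fun k _ => Set.image_mono subset_closure

lemma s9_perfDom_shift {n : ℕ} (ε : ℝ) (Ystar : Set (Vec n)) (O P : Set (Vec n)) (ℓ : Fin n → ℤ)
    (hOP : ∀ k ∈ Keps ε O, k + ℓ ∈ Keps ε P) :
    perfDom ε O Ystar ⊆ shiftPt ε ℓ ⁻¹' perfDom ε P Ystar := by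
  intro x hx
  have hcont : Continuous (shiftPt (n := n) ε (-ℓ)) := by unfold shiftPt; fun_prop
  have hinv : ∀ x, shiftPt ε (-ℓ) (shiftPt ε ℓ x) = x := by
    intro x; funext i; simp [shiftPt]
  have hinv' : ∀ x, shiftPt ε ℓ (shiftPt ε (-ℓ) x) = x := by
    intro x; funext i; simp [shiftPt]
  have ho : IsOpen (shiftPt ε (-ℓ) ⁻¹' perfDom ε O Ystar) :=
    isOpen_interior.preimage hcont
  refine interior_maximal (s := ⋃ k ∈ Keps ε P, cellAt ε (closure Ystar) k) ?_ ho
    (show _ ∈ perfDom ε O Ystar by rwa [hinv])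
  intro y hy
  have hy' := interior_subset hy
  simp only [Set.mem_iUnion] at hy' ⊢
  obtain ⟨k, hk, u, hu, hux⟩ := hy'
  refine ⟨k + ℓ, hOP k hk, u, hu, ?_⟩
  rw [← hinv' y, ← hux]
  funext i
  simp [shiftPt]; ring

/-- Estimate of differences of shifted unfolded functions by differences
of shifts of the function itself: for `|z| < h`,
`‖𝓣_ε v(·, ·+z, ·) − 𝓣_ε v‖²_{L²((0,T)×Ω^{2h}×Y*)} ≤ ∑_{j∈{0,1}ⁿ} ‖δ_ℓ v‖²_{L²((0,T)×Ω_ε^h)}`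
with `ℓ = j + [z/ε]`. -/
theorem statement_9 {n : ℕ} (T : ℝ) (a b : Fin n → ℕ) (Ω Ystar Γ : Set (Vec n)) (εs : ℕ → ℝ)
    (hgeom : GeomOK n T a b Ω Ystar Γ εs)
    (ε : ℝ) (hε : 0 < ε) (hεN : ∃ N : ℕ, ε * N = 1)
    (h : ℝ) (hh : 0 < h) (hεh : ε < h)
    (z : Vec n) (hz : nrm2 z < h)
    (v : ℝ → Vec n → ℝ)
    (hmv : Measurable (fun p : ℝ × Vec n => v p.1 p.2))
    (hv2 : IntegrableOn (fun p : ℝ × Vec n => (v p.1 p.2)^2)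
        ((Set.Ioo 0 T) ×ˢ (perfDom ε Ω Ystar))) :
    (∫ t in Set.Ioo 0 T, ∫ x in innerDom (2*h) Ω, ∫ y in Ystar,
        (unf ε (v t) (fun i => x i + z i) y - unf ε (v t) x y)^2)
      ≤ ∑ j : Fin n → Bool, ∫ t in Set.Ioo 0 T, ∫ x in perfDomH ε h Ω Ystar,
          (shiftDiff ε (fun i => (if j i then 1 else 0) + ⌊z i / ε⌋) (v t) x)^2 := by
  obtain ⟨hT, hn, hab, rfl, hYo, -, hYs, -, -, -, -⟩ := hgeom
  obtain ⟨N, hN⟩ := hεN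
  have hzi : ∀ i, |z i| < h := fun i => (s9_abs_le_nrm2 z i).trans_lt hz
  set A : Vec n := fun i => (a i : ℝ)
  set B : Vec n := fun i => (b i : ℝ)
  have hI := s9_innerDom_eq hn A B (2 * h) (by linarith)
  have hO := s9_innerDom_eq hn A B h hh
  have hsubK : ∀ x ∈ innerDom (2 * h) (rect A B),
      (fun i => ⌊x i / ε⌋) ∈ Keps ε (innerDom h (rect A B)) := by
    intro x hx
    rw [hI] at hx
    rw [hO, s9_Keps_iff ε hε]
    intro i
    have h1 := Int.floor_le (x i / ε)
    have h2 := Int.lt_floor_add_one (x i / ε)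
    rw [le_div_iff₀ hε] at h1
    rw [div_lt_iff₀ hε] at h2
    have := hx i
    constructor <;> dsimp only at * <;> nlinarith
  have hsh : ∀ j : Fin n → Bool, ∀ k ∈ Keps ε (innerDom h (rect A B)),
      k + (fun i => (if j i then 1 else 0) + ⌊z i / ε⌋) ∈ Keps ε (rect A B) := by
    intro j k hk
    rw [hO, s9_Keps_iff ε hε] at hk
    rw [s9_Keps_iff ε hε]
    intro i
    have h1 := Int.floor_le (z i / ε)
    have h2 := Int.lt_floor_add_one (z i / ε)
    rw [le_div_iff₀ hε] at h1
    rw [div_lt_iff₀ hε] at h2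
    have hz' := abs_lt.1 (hzi i)
    obtain ⟨h3, h4⟩ := hk i
    have hA : A i = ε * ((a i * N : ℤ) : ℝ) := by
      push_cast; rw [mul_left_comm, hN]; simp [A]
    have hB : B i = ε * ((b i * N : ℤ) : ℝ) := by
      push_cast; rw [mul_left_comm, hN]; simp [B]
    have hc : (0:ℝ) ≤ ((if j i then 1 else 0 : ℤ) : ℝ) ∧ ((if j i then 1 else 0 : ℤ) : ℝ) ≤ 1 := by
      split_ifs <;> simp
    set c : ℤ := if j i then 1 else 0
    set m : ℤ := k i + (c + ⌊z i / ε⌋) with hm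
    have hmr : (m : ℝ) = k i + (c + ⌊z i / ε⌋) := by rw [hm]; push_cast; ring
    change A i ≤ ε * (m : ℝ) ∧ ε * ((m : ℝ) + 1) ≤ B i
    have hc1 := mul_nonneg hε.le hc.1
    have hc2 := mul_le_mul_of_nonneg_left hc.2 hε.le
    constructor
    · rw [hA] at h3 ⊢
      have : ε * ((a i * N : ℤ) : ℝ) < ε * ((m + 1 : ℤ) : ℝ) := by
        push_cast at *; rw [hmr]; nlinarith
      have := lt_of_mul_lt_mul_left this hε.le
      have : (a i * N : ℤ) ≤ m := Int.lt_add_one_iff.1 (by exact_mod_cast this)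
      exact mul_le_mul_of_nonneg_left (by exact_mod_cast this) hε.le
    · rw [hB] at h4 ⊢
      have : ε * ((m : ℤ) : ℝ) < ε * ((b i * N : ℤ) : ℝ) := by
        push_cast at *; rw [hmr]; nlinarith
      have := lt_of_mul_lt_mul_left this hε.le
      have : m + 1 ≤ (b i * N : ℤ) := by
        have : m < (b i * N : ℤ) := by exact_mod_cast this
        omega
      exact mul_le_mul_of_nonneg_left (by exact_mod_cast this) hε.le
  have hmsh : ∀ ℓ : Fin n → ℤ, Measurable (fun p : ℝ × Vec n => v p.1 (shiftPt ε ℓ p.2)) := by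
    intro ℓ
    have : Measurable (fun p : ℝ × Vec n => (p.1, shiftPt ε ℓ p.2)) := by
      unfold shiftPt; fun_prop
    exact hmv.comp this
  have hmd : ∀ ℓ : Fin n → ℤ, Measurable (fun p : ℝ × Vec n => (shiftDiff ε ℓ (v p.1) p.2)^2) :=
    fun ℓ => ((hmsh ℓ).sub hmv).pow_const 2
  set P := perfDom ε (rect A B) Ystar with hP
  have hPH : perfDomH ε h (rect A B) Ystar = perfDom ε (innerDom h (rect A B)) Ystar := rfl
  rw [hPH]
  set Q := perfDom ε (innerDom h (rect A B)) Ystar with hQ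
  have hPo : IsOpen P := isOpen_interior
  have hQo : IsOpen Q := isOpen_interior
  have hQP : Q ⊆ P := by
    have := s9_perfDom_shift ε Ystar (innerDom h (rect A B)) (rect A B) 0 (by
      intro k hk
      rw [add_zero]
      exact fun x hx => (hk hx).1)
    intro x hx
    have h1 := this hx
    have h2 : shiftPt ε 0 x = x := by funext i; simp [shiftPt]
    rw [Set.mem_preimage, h2] at h1
    exact h1
  have hint : ∀ j : Fin n → Bool, IntegrableOn (fun p : ℝ × Vec n =>
      (shiftDiff ε (fun i => (if j i then 1 else 0) + ⌊z i / ε⌋) (v p.1) p.2)^2)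
      (Set.Ioo 0 T ×ˢ Q) := by
    intro j
    set ℓ : Fin n → ℤ := fun i => (if j i then 1 else 0) + ⌊z i / ε⌋ with hℓ
    have i1 : IntegrableOn (fun p : ℝ × Vec n => (v p.1 p.2)^2) (Set.Ioo 0 T ×ˢ Q) :=
      hv2.mono_set (Set.prod_mono_right hQP)
    have i2 : IntegrableOn (fun p : ℝ × Vec n => (v p.1 (shiftPt ε ℓ p.2))^2)
        (Set.Ioo 0 T ×ˢ Q) := by
      haveI : (volume : Measure (ℝ × Vec n)).IsAddRightInvariant := by
        rw [Measure.volume_eq_prod]; infer_instance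
      have hmp : MeasurePreserving (fun p : ℝ × Vec n => p + (0, fun i => ε * (ℓ i : ℝ)))
          volume volume := measurePreserving_add_right volume _
      have hemb : MeasurableEmbedding (fun p : ℝ × Vec n => p + (0, fun i => ε * (ℓ i : ℝ))) :=
        measurableEmbedding_addRight _
      have := (hmp.integrableOn_comp_preimage hemb).2 hv2
      refine IntegrableOn.congr_fun (this.mono_set ?_) ?_ (measurableSet_Ioo.prod hQo.measurableSet)
      · rintro ⟨t, x⟩ ⟨ht, hx⟩
        refine ⟨by simpa using ht, ?_⟩
        exact s9_perfDom_shift ε Ystar _ _ ℓ (hsh j) hx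
      · rintro ⟨t, x⟩ _
        simp only [Function.comp, Prod.mk_add_mk, add_zero]
        rfl
    refine Integrable.mono' ((i1.add i2).const_mul 2) (hmd ℓ).aestronglyMeasurable ?_
    refine Eventually.of_forall fun p => ?_
    rw [Real.norm_eq_abs, abs_of_nonneg (sq_nonneg _)]
    simp only [shiftDiff, Pi.add_apply]
    nlinarith [sq_nonneg (v p.1 (shiftPt ε ℓ p.2) + v p.1 p.2)]
  have hR : ∀ j : Fin n → Bool, ENNReal.ofReal (∫ t in Set.Ioo 0 T, ∫ x in Q,
      (shiftDiff ε (fun i => (if j i then 1 else 0) + ⌊z i / ε⌋) (v t) x)^2) =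
      ∫⁻ t in Set.Ioo 0 T, ∫⁻ x in Q, ENNReal.ofReal
      ((shiftDiff ε (fun i => (if j i then 1 else 0) + ⌊z i / ε⌋) (v t) x)^2) := by
    intro j
    have hi := hint j
    rw [Measure.volume_eq_prod] at hi
    rw [← setIntegral_prod (μ := volume) (ν := volume) (fun p : ℝ × Vec n =>
      (shiftDiff ε (fun i => (if j i then 1 else 0) + ⌊z i / ε⌋) (v p.1) p.2)^2) hi]
    rw [ofReal_integral_eq_lintegral_ofReal hi (Eventually.of_forall fun p => sq_nonneg _)]
    rw [← Measure.prod_restrict, lintegral_prod _ (hmd _).ennreal_ofReal.aemeasurable]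
  have hnn : ∀ j : Fin n → Bool, 0 ≤ ∫ t in Set.Ioo 0 T, ∫ x in Q,
      (shiftDiff ε (fun i => (if j i then 1 else 0) + ⌊z i / ε⌋) (v t) x)^2 :=
    fun j => integral_nonneg fun t => integral_nonneg fun x => sq_nonneg _
  rw [← ENNReal.ofReal_le_ofReal_iff (Finset.sum_nonneg fun j _ => hnn j),
    ENNReal.ofReal_sum_of_nonneg (fun j _ => hnn j), Finset.sum_congr rfl (fun j _ => hR j),
    ← lintegral_finsetSum _ (fun j _ => (hmd _).ennreal_ofReal.lintegral_prod_right')]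
  refine (s9_ofReal_integral_le _ _ fun t => integral_nonneg fun x =>
    integral_nonneg fun y => sq_nonneg _).trans (lintegral_mono fun t => ?_)
  refine le_trans ?_ (s9_space ε hε Ystar hYo hYs _ _ hsubK z (v t) (hmv.comp measurable_prodMk_left))
  refine (s9_ofReal_integral_le _ _ fun x =>
    integral_nonneg fun y => sq_nonneg _).trans (lintegral_mono fun x => ?_)
  exact s9_ofReal_integral_le _ _ fun y => sq_nonneg _
end
end

section
/- For all u_ε, v_ε ∈ L²((0,T)×Ω_ε) the unfolding operator preserves the L² inner product: (u_ε,v_ε)_{L²((0,T)×Ω_ε)} = (𝓣_ε u_ε, 𝓣_ε v_ε)_{L²((0,T)×Ω×Y*)}. -/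
open MeasureTheory Filter Topology Set Matrix

noncomputable section

variable {n : ℕ}

def affC (ε : ℝ) (k : Fin n → ℤ) : Vec n → Vec n := fun y i => ε * (y i + (k i : ℝ))

def hCell (ε : ℝ) (k : Fin n → ℤ) : Set (Vec n) :=
  Set.pi univ (fun i => Ico (ε * (k i : ℝ)) (ε * ((k i : ℝ) + 1)))

def Kfin (N : ℕ) (a b : Fin n → ℕ) : Finset (Fin n → ℤ) :=
  Fintype.piFinset (fun i => Finset.Ico ((N : ℤ) * a i) ((N : ℤ) * b i))

theorem mem_hCell {ε : ℝ} (hε : 0 < ε) (k : Fin n → ℤ) (x : Vec n) :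
    x ∈ hCell ε k ↔ ∀ i, ⌊x i / ε⌋ = k i := by
  simp only [hCell, Set.mem_pi, mem_univ, true_imp_iff, mem_Ico, Int.floor_eq_iff]
  refine forall_congr' fun i => ?_
  rw [le_div_iff₀ hε, div_lt_iff₀ hε, mul_comm ε, mul_comm ε]

theorem Keps_eq {ε : ℝ} (hε : 0 < ε) {N : ℕ} (hN : ε * N = 1) (a b : Fin n → ℕ) :
    Keps ε (rect (fun i => (a i : ℝ)) (fun i => (b i : ℝ))) = ↑(Kfin N a b) := by
  have key : ∀ c : ℕ, (c : ℝ) = ε * (((N : ℤ) * c : ℤ) : ℝ) := by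
    intro c; push_cast; rw [← mul_assoc, hN, one_mul]
  ext k
  simp only [Keps, Kfin, mem_setOf_eq, Finset.mem_coe, Fintype.mem_piFinset, Finset.mem_Ico]
  constructor
  · intro h i
    have h1 : (fun i => ε * ((1/2 : ℝ) + (k i : ℝ))) ∈
        rect (fun i => (a i : ℝ)) (fun i => (b i : ℝ)) :=
      h ⟨fun _ => 1/2, fun i => by norm_num, rfl⟩
    obtain ⟨h2, h3⟩ := h1 i
    simp only at h2 h3
    rw [key] at h2 h3
    have h2 := lt_of_mul_lt_mul_left h2 hε.le
    have h3 := lt_of_mul_lt_mul_left h3 hε.le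
    constructor
    · have : (((N : ℤ) * a i : ℤ) : ℝ) < ((k i + 1 : ℤ) : ℝ) := by
        push_cast at *; linarith
      have := Int.cast_lt.1 this
      omega
    · have : ((k i : ℤ) : ℝ) < (((N : ℤ) * b i : ℤ) : ℝ) := by
        push_cast at *; linarith
      exact Int.cast_lt.1 this
  · rintro h _ ⟨y, hy, rfl⟩ i
    obtain ⟨h1, h2⟩ := h i
    obtain ⟨h3, h4⟩ := hy i
    have h1' : (((N : ℤ) * a i : ℤ) : ℝ) ≤ (k i : ℝ) := by exact_mod_cast h1
    have h2' : (k i : ℝ) + 1 ≤ (((N : ℤ) * b i : ℤ) : ℝ) := by exact_mod_cast h2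
    simp only
    rw [key, key (b i)]
    exact ⟨mul_lt_mul_of_pos_left (by linarith) hε, mul_lt_mul_of_pos_left (by linarith) hε⟩

theorem rect_ae {ε : ℝ} (hε : 0 < ε) {N : ℕ} (hN : ε * N = 1) (a b : Fin n → ℕ) :
    rect (fun i => (a i : ℝ)) (fun i => (b i : ℝ)) =ᵐ[volume]
      (⋃ k ∈ Kfin N a b, hCell ε k : Set (Vec n)) := by
  have e1 : rect (fun i => (a i : ℝ)) (fun i => (b i : ℝ))
      = Set.pi univ (fun i => Ioo (a i : ℝ) (b i : ℝ)) := by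
    ext x; simp [rect]
  have e2 : (⋃ k ∈ Kfin N a b, hCell ε k : Set (Vec n))
      = Set.pi univ (fun i => Ico (a i : ℝ) (b i : ℝ)) := by
    ext x
    simp only [mem_iUnion, mem_hCell hε, Kfin, Fintype.mem_piFinset, Finset.mem_Ico,
      Set.mem_pi, mem_univ, true_imp_iff, mem_Ico, exists_prop]
    have hx : ∀ i, (((N : ℤ) * a i ≤ ⌊x i / ε⌋ ∧ ⌊x i / ε⌋ < (N : ℤ) * b i) ↔
        ((a i : ℝ) ≤ x i ∧ x i < b i)) := by
      intro i
      rw [Int.le_floor, Int.floor_lt, le_div_iff₀ hε, div_lt_iff₀ hε]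
      push_cast
      have h1 : (N : ℝ) * a i * ε = a i := by
        rw [mul_comm, ← mul_assoc, hN, one_mul]
      have h2 : (N : ℝ) * b i * ε = b i := by
        rw [mul_comm, ← mul_assoc, hN, one_mul]
      rw [h1, h2]
    constructor
    · rintro ⟨k, hk, h⟩ i
      rw [← hx, h i]; exact hk i
    · intro h
      exact ⟨fun i => ⌊x i / ε⌋, fun i => (hx i).2 (h i), fun i => rfl⟩
  rw [e1, e2]
  exact (Measure.univ_pi_Ioo_ae_eq_Icc).trans (Measure.univ_pi_Ico_ae_eq_Icc).symm

theorem affC_fderiv (ε : ℝ) (k : Fin n → ℤ) (y : Vec n) :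
    HasFDerivAt (affC ε k) (ε • ContinuousLinearMap.id ℝ (Vec n)) y := by
  have h : affC ε k = fun y => ε • (y + (fun i => (k i : ℝ))) := by
    ext y i; simp [affC]
  rw [h]
  exact ((hasFDerivAt_id y).add_const _).const_smul ε

theorem affC_inj {ε : ℝ} (hε : 0 < ε) (k : Fin n → ℤ) : Function.Injective (affC ε k) := by
  intro x y h
  ext i
  have := congrFun h i
  simp only [affC] at this
  have := mul_left_cancel₀ hε.ne' this
  linarith

theorem affC_open {ε : ℝ} (hε : 0 < ε) (k : Fin n → ℤ) {A : Set (Vec n)} (hA : IsOpen A) :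
    IsOpen (affC ε k '' A) := by
  have h : affC ε k '' A = (fun (x : Vec n) => (fun i => ε⁻¹ * x i - (k i : ℝ) : Vec n)) ⁻¹' A := by
    ext x
    constructor
    · rintro ⟨y, hy, rfl⟩
      simp only [mem_preimage]
      convert hy using 1
      ext i
      simp only [affC]
      field_simp
      ring
    · intro hx
      refine ⟨_, hx, ?_⟩
      ext i
      simp only [affC]
      field_simp
      ring
  rw [h]
  exact hA.preimage (by fun_prop)

theorem perf_ae {ε : ℝ} (hε : 0 < ε) {Ω Ystar : Set (Vec n)} (hY : IsOpen Ystar)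
    (hnull : volume (frontier Ystar) = 0) :
    perfDom ε Ω Ystar =ᵐ[volume] (⋃ k ∈ Keps ε Ω, affC ε k '' Ystar : Set (Vec n)) := by
  have hsub : (⋃ k ∈ Keps ε Ω, affC ε k '' Ystar : Set (Vec n)) ⊆ perfDom ε Ω Ystar := by
    refine interior_maximal ?_ (isOpen_biUnion fun k _ => affC_open hε k hY)
    exact iUnion₂_mono fun k _ => image_mono subset_closure
  refine Filter.EventuallyLE.antisymm ?_ hsub.eventuallyLE
  rw [ae_le_set]
  have hz : volume (⋃ k : Fin n → ℤ, affC ε k '' frontier Ystar) = 0 := by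
    rw [measure_iUnion_null_iff]
    intro k
    exact addHaar_image_eq_zero_of_differentiableOn_of_addHaar_eq_zero volume
      (fun y _ => (affC_fderiv ε k y).differentiableAt.differentiableWithinAt) hnull
  refine measure_mono_null ?_ hz
  rintro x ⟨hx, hx'⟩
  have hx := interior_subset hx
  simp only [mem_iUnion, exists_prop, not_exists, not_and] at hx hx' ⊢
  obtain ⟨k, hk, y, hy, rfl⟩ := hx
  refine ⟨k, y, ?_, rfl⟩
  rw [frontier, hY.interior_eq]
  exact ⟨hy, fun h => hx' k hk ⟨y, h, rfl⟩⟩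

theorem affC_sub_hCell {ε : ℝ} (hε : 0 < ε) {Ystar : Set (Vec n)} (hsub : Ystar ⊆ unitCell n)
    (k : Fin n → ℤ) : affC ε k '' Ystar ⊆ hCell ε k := by
  rintro _ ⟨y, hy, rfl⟩ i _
  obtain ⟨h1, h2⟩ := hsub hy i
  exact ⟨mul_le_mul_of_nonneg_left (by linarith) hε.le,
    mul_lt_mul_of_pos_left (by linarith) hε⟩

theorem hCell_disj {ε : ℝ} (hε : 0 < ε) {k l : Fin n → ℤ} (h : k ≠ l) :
    Disjoint (hCell ε k) (hCell ε l) := by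
  rw [Set.disjoint_left]
  intro x hx hx'
  rw [mem_hCell hε] at hx hx'
  exact h (funext fun i => (hx i).symm.trans (hx' i))

theorem hCell_meas (ε : ℝ) (k : Fin n → ℤ) : MeasurableSet (hCell ε k) :=
  MeasurableSet.univ_pi fun _ => measurableSet_Ico

theorem hCell_vol {ε : ℝ} (hε : 0 < ε) (k : Fin n → ℤ) :
    (volume (hCell ε k)).toReal = ε ^ n := by
  rw [hCell, Real.volume_pi_Ico_toReal]
  · simp [mul_add]
  · intro i
    exact mul_le_mul_of_nonneg_left (by linarith) hε.le

theorem hCell_fin (ε : ℝ) (k : Fin n → ℤ) : volume (hCell ε k) ≠ ⊤ := by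
  rw [hCell, Real.volume_pi_Ico]
  exact (ENNReal.prod_lt_top fun i _ => ENNReal.ofReal_lt_top).ne

theorem unfold_space {ε : ℝ} (hε : 0 < ε) {N : ℕ} (hN : ε * N = 1) (a b : Fin n → ℕ)
    {Ystar : Set (Vec n)} (hY : IsOpen Ystar) (hsub : Ystar ⊆ unitCell n)
    (hnull : volume (frontier Ystar) = 0) (w : Vec n → ℝ)
    (hw : IntegrableOn w (perfDom ε (rect (fun i => (a i : ℝ)) (fun i => (b i : ℝ))) Ystar)) :
    ∫ x in perfDom ε (rect (fun i => (a i : ℝ)) (fun i => (b i : ℝ))) Ystar, w x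
      = ∫ x in rect (fun i => (a i : ℝ)) (fun i => (b i : ℝ)), ∫ y in Ystar, unf ε w x y := by
  have hp := perf_ae hε (Ω := rect (fun i => (a i : ℝ)) (fun i => (b i : ℝ))) hY hnull
  rw [Keps_eq hε hN] at hp
  simp only [Finset.mem_coe] at hp
  have hw' := hw.congr_set_ae hp.symm
  have hcell : ∀ k, ∀ x ∈ hCell ε k, ∫ y in Ystar, unf ε w x y
      = ∫ y in Ystar, w (affC ε k y) := by
    intro k x hx
    rw [mem_hCell hε] at hx
    congr 1
    ext y
    simp only [unf, cellCorner, hx]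
    congr 1
    ext i
    simp only [affC]
    ring
  rw [setIntegral_congr_set hp, setIntegral_congr_set (rect_ae hε hN a b),
    integral_biUnion_finset, integral_biUnion_finset]
  · refine Finset.sum_congr rfl fun k _ => ?_
    rw [setIntegral_congr_fun (hCell_meas ε k) (hcell k), setIntegral_const, Measure.real,
      hCell_vol hε,
      integral_image_eq_integral_abs_det_fderiv_smul volume hY.measurableSet
        (fun y _ => (affC_fderiv ε k y).hasFDerivWithinAt) (affC_inj hε k).injOn,
      integral_smul]
    congr 1
    have : (ε • ContinuousLinearMap.id ℝ (Vec n)).det = ε ^ n := by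
      simp [ContinuousLinearMap.det, LinearMap.det_smul]
    rw [this, abs_of_pos (pow_pos hε n)]
  · exact fun k _ => hCell_meas ε k
  · exact fun k _ l _ h => hCell_disj hε h
  · intro k _
    exact (integrableOn_const (C := ∫ y in Ystar, w (affC ε k y)) (hCell_fin ε k)).congr_fun
      (fun x hx => (hcell k x hx).symm) (hCell_meas ε k)
  · exact fun k _ => (affC_open hε k hY).measurableSet
  · exact fun k _ l _ h => (hCell_disj hε h).mono (affC_sub_hCell hε hsub k)
      (affC_sub_hCell hε hsub l)
  · intro k hk
    exact hw'.mono_set (subset_biUnion_of_mem (u := fun k => affC ε k '' Ystar) hk)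

/-- The unfolding operator preserves the `L²` inner product:
`(u,v)_{L²((0,T)×Ω_ε)} = (𝓣_ε u, 𝓣_ε v)_{L²((0,T)×Ω×Y*)}`. -/
theorem statement_15 {n : ℕ} (T : ℝ) (a b : Fin n → ℕ) (Ω Ystar Γ : Set (Vec n)) (εs : ℕ → ℝ)
    (hgeom : GeomOK n T a b Ω Ystar Γ εs)
    (hnull : volume (frontier Ystar) = 0)
    (ε : ℝ) (hε : 0 < ε) (hεN : ∃ N : ℕ, ε * N = 1)
    (u v : ℝ → Vec n → ℝ)
    (hmu : Measurable (fun p : ℝ × Vec n => u p.1 p.2))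
    (hmv : Measurable (fun p : ℝ × Vec n => v p.1 p.2))
    (hu : IntegrableOn (fun p : ℝ × Vec n => (u p.1 p.2)^2)
        ((Set.Ioo 0 T) ×ˢ (perfDom ε Ω Ystar)))
    (hv : IntegrableOn (fun p : ℝ × Vec n => (v p.1 p.2)^2)
        ((Set.Ioo 0 T) ×ˢ (perfDom ε Ω Ystar))) :
    ∫ t in Set.Ioo 0 T, ∫ x in perfDom ε Ω Ystar, u t x * v t x
      = ∫ t in Set.Ioo 0 T, ∫ x in Ω, ∫ y in Ystar, unf ε (u t) x y * unf ε (v t) x y := by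
  obtain ⟨-, -, -, rfl, hY, -, hsub, -, -, -, -⟩ := hgeom
  obtain ⟨N, hN⟩ := hεN
  have hint : IntegrableOn (fun p : ℝ × Vec n => u p.1 p.2 * v p.1 p.2)
      ((Set.Ioo 0 T) ×ˢ
        (perfDom ε (rect (fun i => (a i : ℝ)) (fun i => (b i : ℝ))) Ystar)) := by
    refine Integrable.mono' (hu.add hv) (hmu.mul hmv).aestronglyMeasurable ?_
    refine Filter.Eventually.of_forall fun p => ?_
    simp only [Pi.add_apply, Real.norm_eq_abs]
    rw [abs_le]
    constructor <;> nlinarith [sq_nonneg (u p.1 p.2 + v p.1 p.2),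
      sq_nonneg (u p.1 p.2 - v p.1 p.2), sq_nonneg (u p.1 p.2), sq_nonneg (v p.1 p.2)]
  rw [IntegrableOn, Measure.volume_eq_prod, ← Measure.prod_restrict] at hint
  refine integral_congr_ae ?_
  filter_upwards [hint.prod_right_ae] with t ht
  exact unfold_space hε hN a b hY hsub hnull (fun x => u t x * v t x) ht
end
end
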